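/- arXiv:1005.1725 — 2 statements merged into one kernel-verified Lean document; each statement's English description precedes it below -/
import Mathlib

section
/- Let α ∈ (0,2], let A generate an α-times resolvent family S_α on a complex Banach space X, and let f ∈ L¹_loc([0,τ);X). If the problem (ACP) with zero initial values x_0 = ⋯ = x_{m−1} = 0 has a mild solution, then the function t ↦ (g_α * S_α * f)(t) is differentiable on [0,τ) and the mild solution is u(t) = (d/dt)(g_α * S_α * f)(t). More generally, for x_0,…,x_{m−1} ∈ X, the mild solution of (ACP) is given by u(t) = Σ_{k=0}^{m−1} (g_k * S_α)(t) x_k + (d/dt)(g_α * S_α * f)(t), t ≥ 0 (where g_0 * S_α = S_α). -/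
open MeasureTheory Filter Set Topology Metric
open scoped Real Topology ENNReal

attribute [local instance] Classical.propDecidable
noncomputable section

variable {X : Type*} [NormedAddCommGroup X] [NormedSpace ℂ X] [CompleteSpace X]

/-- The kernel `g_β(t) = t^(β-1)/Γ(β)` for `t ≥ 0`, and `0` for `t < 0`. -/
def gk (β t : ℝ) : ℝ := if 0 ≤ t then t ^ (β - 1) / Real.Gamma β else 0

/-- Application of a partial (unbounded) linear operator, extended by `0` off its domain. -/
def pApply (A : X →ₗ.[ℂ] X) (x : X) : X := if h : x ∈ A.domain then A ⟨x, h⟩ else 0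

/-- The negative `-A` of a partial linear operator. -/
def negP (A : X →ₗ.[ℂ] X) : X →ₗ.[ℂ] X := { domain := A.domain, toFun := -A.toFun }

/-- `R` is the resolvent operator `(μ - A)⁻¹` of `A` at `μ`. -/
def IsResolventOp (A : X →ₗ.[ℂ] X) (μ : ℂ) (R : X →L[ℂ] X) : Prop :=
  (∀ y : X, ∃ hy : R y ∈ A.domain, μ • R y - A ⟨R y, hy⟩ = y) ∧
  (∀ x : X, ∀ hx : x ∈ A.domain, R (μ • x - A ⟨x, hx⟩) = x)

def pResolventSet (A : X →ₗ.[ℂ] X) : Set ℂ := {μ | ∃ R, IsResolventOp A μ R}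

def resolventOf (A : X →ₗ.[ℂ] X) (μ : ℂ) : X →L[ℂ] X :=
  if h : ∃ R, IsResolventOp A μ R then h.choose else 0

/-- The open sector `Σ_ω` of half-angle `ω` around the positive axis. -/
def sector (ω : ℝ) : Set ℂ :=
  if ω = 0 then {z : ℂ | 0 < z.re ∧ z.im = 0} else {z : ℂ | z ≠ 0 ∧ |z.arg| < ω}

/-- `A` is a (densely defined, closed) sectorial operator of angle `ω`. -/
def IsSectorial (A : X →ₗ.[ℂ] X) (ω : ℝ) : Prop :=
  Dense (A.domain : Set X) ∧ IsClosed (A.graph : Set (X × X)) ∧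
  (pResolventSet A)ᶜ ⊆ closure (sector ω) ∧
  ∀ ω' ∈ Ioo ω π, ∃ M : ℝ, ∀ z ∈ (closure (sector ω'))ᶜ, ‖z • resolventOf A z‖ ≤ M

/-- `S` is an `α`-times resolvent family generated by `A`. -/
def IsResolventFamily (α : ℝ) (A : X →ₗ.[ℂ] X) (S : ℝ → X →L[ℂ] X) : Prop :=
  (∀ x : X, ContinuousOn (fun t => S t x) (Ici 0)) ∧
  S 0 = ContinuousLinearMap.id ℂ X ∧
  (∀ t ∈ Ici (0:ℝ), ∀ x : X, ∀ hx : x ∈ A.domain,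
      ∃ h2 : S t x ∈ A.domain, A ⟨S t x, h2⟩ = S t (A ⟨x, hx⟩)) ∧
  (∀ t ∈ Ici (0:ℝ), ∀ x : X, ∀ hx : x ∈ A.domain,
      S t x = x + ∫ s in (0:ℝ)..t, gk α (t - s) • S s (A ⟨x, hx⟩))

/-- `A ∈ 𝒜_α(θ₀)`: `A` generates an `α`-times resolvent family which extends analytically
to the sector `Σ_{θ₀}` and is bounded on each smaller sector. -/
def InAnalyticClass (α : ℝ) (A : X →ₗ.[ℂ] X) (θ₀ : ℝ) : Prop :=
  ∃ (S : ℝ → X →L[ℂ] X) (T : ℂ → X →L[ℂ] X),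
    IsResolventFamily α A S ∧
    DifferentiableOn ℂ T (sector θ₀) ∧
    (∀ t : ℝ, 0 < t → T t = S t) ∧
    ∀ θ ∈ Ioo 0 θ₀, ∃ M : ℝ, ∀ z ∈ sector θ, ‖T z‖ ≤ M

def cray (r φ : ℝ) : ℂ := (r : ℂ) * Complex.exp ((φ : ℂ) * Complex.I)

/-- Integral over the keyhole contour from `∞e^{-iφ}` to `∞e^{iφ}` (the two rays of modulus
`≥ d`, avoiding the origin via the arc of radius `d`), of an operator-valued function. -/
def keyhole (G : ℂ → X →L[ℂ] X) (φ d : ℝ) : X →L[ℂ] X :=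
  (∫ r in Ioi d, Complex.exp ((φ : ℂ) * Complex.I) • G (cray r φ)) -
  (∫ r in Ioi d, Complex.exp (-(φ : ℂ) * Complex.I) • G (cray r (-φ))) +
  (∫ θ in Ioo (-φ) φ, (Complex.I * cray d θ) • G (cray d θ))

/-- `A^{-b}`, via the contour integral `-(2πi)⁻¹ ∫_{Γ(ζ)} λ^{-b} (λ - A)⁻¹ dλ`. -/
def negFracPow (A : X →ₗ.[ℂ] X) (b ζ d : ℝ) : X →L[ℂ] X :=
  (-(2 * (π : ℂ) * Complex.I)⁻¹) • keyhole (fun μ => (μ ^ (-(b : ℂ))) • resolventOf A μ) ζ d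

/-- `A^b := (A^{-b})⁻¹`, as a partial linear operator (for `0 ∈ ρ(A)`), defined through the
inverse (flipped) graph of the bounded operator `A^{-b}`. -/
def fracPowC (A : X →ₗ.[ℂ] X) (b ζ d : ℝ) : X →ₗ.[ℂ] X :=
  (Submodule.map ((LinearEquiv.prodComm ℂ X X).toLinearMap)
    (LinearMap.graph ((negFracPow A b ζ d : X →L[ℂ] X) : X →ₗ[ℂ] X))).toLinearPMap

/-- `A^b` with a canonical choice of the inner radius of the contour. -/
def fracPowC' (A : X →ₗ.[ℂ] X) (b ζ : ℝ) : X →ₗ.[ℂ] X :=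
  if h : ∃ d : ℝ, 0 < d ∧ closedBall (0 : ℂ) d ⊆ pResolventSet A
  then fracPowC A b ζ h.choose
  else (⊥ : Submodule ℂ (X × X)).toLinearPMap

/-- The shifted operator `A + ε`. -/
def shiftOp (A : X →ₗ.[ℂ] X) (ε : ℝ) : X →ₗ.[ℂ] X :=
  { domain := A.domain
    toFun := A.toFun + (ε : ℂ) • A.domain.subtype }

/-- The fractional power `A^b` in general: the strong limit of `(A + ε)^b` as `ε → 0⁺`. -/
def fracPow (A : X →ₗ.[ℂ] X) (b ζ : ℝ) : X →ₗ.[ℂ] X :=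
  (Submodule.span ℂ {p : X × X |
    Tendsto (fun ε : ℝ => pApply (fracPowC' (shiftOp A ε) b ζ) p.1) (𝓝[>] 0) (𝓝 p.2)}).toLinearPMap

/-- The Mittag-Leffler function `E_a(z) = Σ zⁿ/Γ(an+1)`. -/
def mlE (a : ℝ) (z : ℂ) : ℂ := ∑' n : ℕ, z ^ n / Complex.Gamma ((a * n + 1 : ℝ) : ℂ)


/-- The stable density `p_α(t,s)` (Yosida's formula), written with contour parameter `θ`. -/
def pKer (α θ t s : ℝ) : ℝ :=
  (1 / π) * ∫ ρ in Ioi (0:ℝ),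
    Real.exp (s * ρ * Real.cos θ - t * ρ ^ α * Real.cos (α * θ)) *
    Real.sin (s * ρ * Real.sin θ - t * ρ ^ α * Real.sin (α * θ) + θ)

/-- The Wright-type function `Φ_γ(z) = Σ (-z)ⁿ/(n! Γ(-γn+1-γ))`. -/
def wrightPhi (γ z : ℝ) : ℝ :=
  ∑' n : ℕ, (-z) ^ n / ((n.factorial : ℝ) * Real.Gamma (-γ * n + 1 - γ))

/-- `φ_γ(t,s) = t^{-γ} Φ_γ(s t^{-γ})`. -/
def phiK (γ t s : ℝ) : ℝ := t ^ (-γ) * wrightPhi γ (s * t ^ (-γ))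

/-- The interval `[0, τ)` for `τ ∈ (0, ∞]`. -/
def Jset (τ : ℝ≥0∞) : Set ℝ := {t : ℝ | 0 ≤ t ∧ ENNReal.ofReal t < τ}

/-- Convolution of a scalar kernel with a vector-valued function: `(k * u)(t)`. -/
def convK (k : ℝ → ℝ) (u : ℝ → X) (t : ℝ) : X := ∫ s in (0:ℝ)..t, k (t - s) • u s

/-- Convolution of an operator family with a vector-valued function: `(S * f)(t)`. -/
def convSf (S : ℝ → X →L[ℂ] X) (f : ℝ → X) (t : ℝ) : X := ∫ s in (0:ℝ)..t, (S (t - s)) (f s)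

/-- `(g_β * u)(t)`, with the convention that `g_0 = δ`, so `g_0 * u = u`. -/
def convK0 (β : ℝ) (u : ℝ → X) (t : ℝ) : X := if β = 0 then u t else convK (gk β) u t

/-- `u` is a mild solution of `D_t^α u = Au + f`, `u^{(k)}(0) = x_k` on `[0,τ)`:
`u ∈ C([0,τ);X)`, `(g_α * u)(t) ∈ D(A)` and
`u(t) = Σ_{k<m} g_{k+1}(t) x_k + A(g_α * u)(t) + (g_α * f)(t)`, where `m = ⌈α⌉`. -/
def IsMildSolution (α : ℝ) (A : X →ₗ.[ℂ] X) (τ : ℝ≥0∞) (f : ℝ → X) (x : ℕ → X)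
    (u : ℝ → X) : Prop :=
  ContinuousOn u (Jset τ) ∧
  ∀ t ∈ Jset τ, ∃ h : convK (gk α) u t ∈ A.domain,
    u t = (∑ k ∈ Finset.range ⌈α⌉₊, gk ((k : ℝ) + 1) t • x k) +
      A ⟨convK (gk α) u t, h⟩ + convK (gk α) f t

/-- Fubini's theorem on the triangle `0 < r ≤ s ≤ t`. -/
theorem integral_triangle_swap {E : Type*} [NormedAddCommGroup E] [NormedSpace ℝ E]
    {t : ℝ} (ht : 0 ≤ t) {F : ℝ → ℝ → E}
    (hF : Integrable (Function.uncurry F)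
      ((volume.restrict (Ioc 0 t)).prod (volume.restrict (Ioc 0 t)))) :
    IntervalIntegrable (fun r => ∫ s in r..t, F s r) volume 0 t ∧
      IntervalIntegrable (fun s => ∫ r in (0:ℝ)..s, F s r) volume 0 t ∧
      ∫ s in (0:ℝ)..t, ∫ r in (0:ℝ)..s, F s r = ∫ r in (0:ℝ)..t, ∫ s in r..t, F s r := by
  set T : Set (ℝ × ℝ) := {p | p.2 ≤ p.1}
  have hT : MeasurableSet T := measurableSet_le measurable_snd measurable_fst
  have hG := hF.indicator hT
  have h1 : ∀ s ∈ Ioc 0 t, ∫ r in Ioc 0 t, T.indicator (Function.uncurry F) (s, r)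
      = ∫ r in (0:ℝ)..s, F s r := by
    intro s hs
    have : (fun r => T.indicator (Function.uncurry F) (s, r)) = (Iic s).indicator (F s) := by
      ext r; simp [T, indicator, Function.uncurry]
    rw [this, setIntegral_indicator measurableSet_Iic, intervalIntegral.integral_of_le hs.1.le,
      Ioc_inter_Iic, min_eq_right hs.2]
  have h2 : ∀ r ∈ Ioc 0 t, ∫ s in Ioc 0 t, T.indicator (Function.uncurry F) (s, r)
      = ∫ s in r..t, F s r := by
    intro r hr
    have : (fun s => T.indicator (Function.uncurry F) (s, r))
        = (Ici r).indicator (fun s => F s r) := by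
      ext s; simp [T, indicator, Function.uncurry]
    have h' : Ioc 0 t ∩ Ici r = Icc r t := by
      ext s
      simp only [mem_inter_iff, mem_Ioc, mem_Ici, mem_Icc]
      constructor
      · rintro ⟨h, h'⟩; exact ⟨h', h.2⟩
      · rintro ⟨h, h'⟩; exact ⟨⟨hr.1.trans_le h, h'⟩, h⟩
    rw [this, setIntegral_indicator measurableSet_Ici, intervalIntegral.integral_of_le hr.2,
      h', integral_Icc_eq_integral_Ioc]
  refine ⟨?_, ?_, ?_⟩
  · rw [intervalIntegrable_iff_integrableOn_Ioc_of_le ht]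
    exact IntegrableOn.congr_fun hG.integral_prod_right h2 measurableSet_Ioc
  · rw [intervalIntegrable_iff_integrableOn_Ioc_of_le ht]
    exact IntegrableOn.congr_fun hG.integral_prod_left h1 measurableSet_Ioc
  · rw [intervalIntegral.integral_of_le ht, intervalIntegral.integral_of_le ht,
      ← setIntegral_congr_fun measurableSet_Ioc h1, ← setIntegral_congr_fun measurableSet_Ioc h2]
    exact integral_integral_swap (f := fun s r => T.indicator (Function.uncurry F) (s, r)) hG

/-- A strongly continuous operator family on `[0, ∞)` is bounded on bounded intervals. -/
theorem exists_norm_le_of_strongly_continuous {S : ℝ → X →L[ℂ] X}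
    (hS : ∀ x, ContinuousOn (fun t => S t x) (Ici 0)) (b : ℝ) :
    ∃ M, ∀ q, q ≤ b → ‖S (max q 0)‖ ≤ M := by
  have : ∃ M, ∀ q : Icc (0:ℝ) (max b 0), ‖S q‖ ≤ M := by
    refine banach_steinhaus fun x => ?_
    obtain ⟨C, hC⟩ := isCompact_Icc.exists_bound_of_continuousOn
      ((hS x).mono (Icc_subset_Ici_self : Icc 0 (max b 0) ⊆ Ici 0))
    exact ⟨C, fun q => hC q q.2⟩
  obtain ⟨M, hM⟩ := this
  exact ⟨M, fun q hq => hM ⟨max q 0, le_max_right _ _, max_le_max_right 0 hq⟩⟩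

theorem continuous_uncurry_of_strongly_continuous {S : ℝ → X →L[ℂ] X}
    (hS : ∀ x, ContinuousOn (fun t => S t x) (Ici 0)) :
    Continuous (fun p : ℝ × X => S (max p.1 0) p.2) := by
  rw [continuous_iff_continuousAt]
  rintro ⟨q₀, x₀⟩
  obtain ⟨M, hM⟩ := exists_norm_le_of_strongly_continuous hS (q₀ + 1)
  have hc : Continuous (fun q : ℝ => S (max q 0) x₀) :=
    (hS x₀).comp_continuous (by fun_prop) fun q => mem_Ici.2 (le_max_right _ _)
  have h1 : Tendsto (fun p : ℝ × X => S (max p.1 0) x₀) (𝓝 (q₀, x₀)) (𝓝 (S (max q₀ 0) x₀)) :=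
    (hc.comp continuous_fst).tendsto (q₀, x₀)
  have h2 : Tendsto (fun p : ℝ × X => S (max p.1 0) (p.2 - x₀)) (𝓝 (q₀, x₀)) (𝓝 0) := by
    have h3 : Tendsto (fun p : ℝ × X => M * ‖p.2 - x₀‖) (𝓝 (q₀, x₀)) (𝓝 0) := by
      have : Continuous (fun p : ℝ × X => M * ‖p.2 - x₀‖) := by fun_prop
      simpa using this.tendsto (q₀, x₀)
    refine squeeze_zero_norm' ?_ h3
    have : ∀ᶠ p : ℝ × X in 𝓝 (q₀, x₀), p.1 < q₀ + 1 :=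
      (continuous_fst.tendsto (q₀, x₀)).eventually (gt_mem_nhds (by simp))
    filter_upwards [this] with p hp
    exact (S (max p.1 0)).le_of_opNorm_le (hM _ hp.le) _
  have := h2.add h1
  simpa [ContinuousAt] using this

theorem integrable_apply_of_strongly_continuous {S : ℝ → X →L[ℂ] X}
    (hS : ∀ x, ContinuousOn (fun t => S t x) (Ici 0))
    {Ω : Type*} [MeasurableSpace Ω] {ν : Measure Ω} {q : Ω → ℝ} (hq : Measurable q) {b : ℝ}
    (hb : ∀ᵐ p ∂ν, q p ≤ b) {Φ : Ω → X} (hΦ : Integrable Φ ν) :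
    Integrable (fun p => S (max (q p) 0) (Φ p)) ν := by
  obtain ⟨M, hM⟩ := exists_norm_le_of_strongly_continuous hS b
  refine (hΦ.norm.const_mul M).mono' ?_ ?_
  · exact (continuous_uncurry_of_strongly_continuous hS).comp_aestronglyMeasurable
      (hq.aestronglyMeasurable.prodMk hΦ.1)
  · filter_upwards [hb] with p hp
    exact (S (max (q p) 0)).le_of_opNorm_le (hM _ hp) _

theorem ae_prod_restrict {a b : ℝ} {P : ℝ × ℝ → Prop}
    (h : ∀ s ∈ Ioc a b, ∀ r ∈ Ioc a b, P (s, r)) :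
    ∀ᵐ p ∂((volume.restrict (Ioc a b)).prod (volume.restrict (Ioc a b))), P p := by
  rw [Measure.prod_restrict]
  filter_upwards [ae_restrict_mem (measurableSet_Ioc.prod measurableSet_Ioc)] with p hp
  exact h p.1 hp.1 p.2 hp.2

/-- Integrability of the integrand of a convolution of a causal scalar kernel with a function. -/
theorem integrable_conv_integrand {E : Type*} [NormedAddCommGroup E] [NormedSpace ℝ E]
    {t : ℝ} {g : ℝ → ℝ} (hg0 : ∀ s < 0, g s = 0)
    (hgi : IntegrableOn g (Icc 0 t)) {f : ℝ → E} (hf : IntegrableOn f (Ioc 0 t)) :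
    Integrable (fun p : ℝ × ℝ => g (p.1 - p.2) • f p.2)
      ((volume.restrict (Ioc 0 t)).prod (volume.restrict (Ioc 0 t))) := by
  have h1 : Integrable ((Icc 0 t).indicator g) := hgi.integrable_indicator measurableSet_Icc
  have h2 : Integrable ((Ioc 0 t).indicator f) := hf.integrable_indicator measurableSet_Ioc
  have h3 := (h2.convolution_integrand (ContinuousLinearMap.lsmul ℝ ℝ).flip h1)
  have h4 := h3.restrict (s := Ioc 0 t ×ˢ Ioc 0 t)
  rw [← Measure.prod_restrict] at h4
  refine h4.congr (ae_prod_restrict fun s hs r hr => ?_)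
  have : (Icc 0 t).indicator g (s - r) = g (s - r) := by
    by_cases h : s - r < 0
    · rw [hg0 _ h, indicator_of_notMem]
      exact fun h' => absurd h'.1 (not_le.2 h)
    · exact indicator_of_mem (mem_Icc.2 ⟨not_lt.1 h, by linarith [hs.2, hr.1]⟩) _
  simp [this, indicator_of_mem hr]

theorem convK_convSf_comm {S : ℝ → X →L[ℂ] X} (hS : ∀ x, ContinuousOn (fun t => S t x) (Ici 0))
    {t : ℝ} (ht : 0 ≤ t) {g : ℝ → ℝ} (hg0 : ∀ s < 0, g s = 0)
    (hgi : IntegrableOn g (Icc 0 t)) {f : ℝ → X} (hf : IntegrableOn f (Ioc 0 t)) :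
    IntervalIntegrable (fun r => convK g (fun s => S s (f r)) (t - r)) volume 0 t ∧
    IntervalIntegrable (convK g f) volume 0 t ∧
    ∫ r in (0:ℝ)..t, convK g (fun s => S s (f r)) (t - r) = convSf S (convK g f) t ∧
    convK g (convSf S f) t = convSf S (convK g f) t := by
  have hgf := integrable_conv_integrand hg0 hgi hf
  have hg' : IntegrableOn (fun s => g (t - s)) (Ioc 0 t) := by
    have := ((intervalIntegrable_iff_integrableOn_Icc_of_le ht).2 hgi).comp_sub_left t
    simp only [sub_zero, sub_self] at this
    exact (intervalIntegrable_iff_integrableOn_Ioc_of_le ht).1 this.symm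
  have hA : Integrable (Function.uncurry fun s r => S (max (t - s) 0) (g (s - r) • f r))
      ((volume.restrict (Ioc 0 t)).prod (volume.restrict (Ioc 0 t))) :=
    integrable_apply_of_strongly_continuous hS (q := fun p : ℝ × ℝ => t - p.1) (by fun_prop) (b := t)
      (ae_prod_restrict fun s hs r hr => by simpa using hs.1.le) hgf
  have hB : Integrable (Function.uncurry fun s r => S (max (s - r) 0) (g (t - s) • f r))
      ((volume.restrict (Ioc 0 t)).prod (volume.restrict (Ioc 0 t))) :=
    integrable_apply_of_strongly_continuous hS (q := fun p : ℝ × ℝ => p.1 - p.2) (by fun_prop) (b := t)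
      (ae_prod_restrict fun s hs r hr => by
        show s - r ≤ t
        linarith [hs.2, hr.1]) (Integrable.smul_prod hg' hf)
  obtain ⟨a1, -, a3⟩ := integral_triangle_swap ht hA
  obtain ⟨-, -, b3⟩ := integral_triangle_swap ht hB
  obtain ⟨-, c2, -⟩ := integral_triangle_swap ht (F := fun s r => g (s - r) • f r) hgf
  have e0 : ∀ r ∈ Icc 0 t, ∫ q in (0:ℝ)..(t - r), S (max q 0) (g (t - r - q) • f r)
      = convK g (fun s => S s (f r)) (t - r) := by
    intro r hr
    refine intervalIntegral.integral_congr fun q hq => ?_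
    rw [uIcc_of_le (by linarith [hr.2])] at hq
    simp [max_eq_left hq.1]
  have e1 : ∀ r ∈ Icc 0 t, ∫ s in r..t, S (max (t - s) 0) (g (s - r) • f r)
      = convK g (fun s => S s (f r)) (t - r) := by
    intro r hr
    have := intervalIntegral.integral_comp_sub_left (a := r) (b := t)
      (fun q => S (max q 0) (g (t - r - q) • f r)) t
    simp only [sub_self] at this
    rw [← e0 r hr, ← this]
    refine intervalIntegral.integral_congr fun s _ => ?_
    simp
  have e2 : ∀ r ∈ Icc 0 t, ∫ s in r..t, S (max (s - r) 0) (g (t - s) • f r)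
      = convK g (fun s => S s (f r)) (t - r) := by
    intro r hr
    have := intervalIntegral.integral_comp_sub_right (a := r) (b := t)
      (fun q => S (max q 0) (g (t - r - q) • f r)) r
    simp only [sub_self] at this
    rw [← e0 r hr, ← this]
    refine intervalIntegral.integral_congr fun s _ => ?_
    simp
  have hu : uIcc 0 t = Icc 0 t := uIcc_of_le ht
  have k1 : ∫ s in (0:ℝ)..t, ∫ r in (0:ℝ)..s, S (max (t - s) 0) (g (s - r) • f r)
      = convSf S (convK g f) t := by
    rw [convSf, intervalIntegral.integral_of_le ht, intervalIntegral.integral_of_le ht]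
    refine integral_congr_ae ?_
    filter_upwards [hgf.prod_right_ae, ae_restrict_mem measurableSet_Ioc] with s hs hst
    rw [max_eq_left (by linarith [hst.2]), convK]
    refine ContinuousLinearMap.intervalIntegral_comp_comm _ ?_
    rw [intervalIntegrable_iff_integrableOn_Ioc_of_le hst.1.le]
    exact IntegrableOn.mono_set hs (Ioc_subset_Ioc_right hst.2)
  have k2 : ∫ s in (0:ℝ)..t, ∫ r in (0:ℝ)..s, S (max (s - r) 0) (g (t - s) • f r)
      = convK g (convSf S f) t := by
    rw [convK]
    refine intervalIntegral.integral_congr fun s hs => ?_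
    rw [hu] at hs
    simp only [convSf]
    rw [← intervalIntegral.integral_smul]
    refine intervalIntegral.integral_congr fun r hr => ?_
    rw [uIcc_of_le hs.1] at hr
    simp [max_eq_left (sub_nonneg.2 hr.2)]
  have k3 : ∫ r in (0:ℝ)..t, convK g (fun s => S s (f r)) (t - r) = convSf S (convK g f) t := by
    rw [← k1, a3]
    exact (intervalIntegral.integral_congr fun r hr => e1 r (hu ▸ hr)).symm
  refine ⟨?_, c2, k3, ?_⟩
  · refine a1.congr fun r hr => e1 r ?_
    rw [uIoc_of_le ht] at hr
    exact Ioc_subset_Icc_self hr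
  · rw [← k3, ← k2, b3]
    exact intervalIntegral.integral_congr fun r hr => e2 r (hu ▸ hr)

theorem gk_of_neg {β s : ℝ} (hs : s < 0) : gk β s = 0 := if_neg (not_le.2 hs)

theorem gk_one {s : ℝ} (hs : 0 ≤ s) : gk 1 s = 1 := by simp [gk, hs]

theorem gk_two {s : ℝ} (hs : 0 ≤ s) : gk 2 s = s := by
  simp [gk, hs, show (2:ℝ) - 1 = 1 by norm_num]

theorem integrableOn_gk {β : ℝ} (hβ : 0 < β) (t : ℝ) : IntegrableOn (gk β) (Icc 0 t) := by
  rcases lt_or_ge t 0 with ht | ht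
  · simp [Icc_eq_empty (not_le.2 ht)]
  have h := (intervalIntegral.intervalIntegrable_rpow' (a := 0) (b := t) (r := β - 1)
    (by linarith)).div_const (Real.Gamma β)
  rw [intervalIntegrable_iff_integrableOn_Icc_of_le ht] at h
  exact h.congr_fun (fun s hs => (if_pos hs.1).symm) measurableSet_Icc

/-- A closed subspace contains the integrals of functions with values in it. -/
theorem integral_prodMk_mem_of_isClosed {G : Submodule ℂ (X × X)}
    (hG : IsClosed (G : Set (X × X))) {t : ℝ} (ht : 0 ≤ t) {a b : ℝ → X}
    (ha : IntervalIntegrable a volume 0 t) (hb : IntervalIntegrable b volume 0 t)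
    (hab : ∀ s ∈ Ioc 0 t, (a s, b s) ∈ G) :
    (∫ s in (0:ℝ)..t, a s, ∫ s in (0:ℝ)..t, b s) ∈ G := by
  have := hG
  have ha' := (intervalIntegrable_iff_integrableOn_Ioc_of_le ht).1 ha
  have hb' := (intervalIntegrable_iff_integrableOn_Ioc_of_le ht).1 hb
  have h1 : ∫ s in Ioc 0 t, G.mkQL (a s, b s) = G.mkQL (∫ s in Ioc 0 t, (a s, b s)) :=
    ContinuousLinearMap.integral_comp_comm _ (ha'.prodMk hb')
  have h2 : ∫ s in Ioc 0 t, G.mkQL (a s, b s) = 0 := by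
    rw [setIntegral_congr_fun (g := fun _ => 0) measurableSet_Ioc]
    · simp
    · intro s hs
      simpa using hab s hs
  rw [h1, integral_pair ha' hb'] at h2
  rw [intervalIntegral.integral_of_le ht, intervalIntegral.integral_of_le ht]
  simpa using h2

theorem intervalIntegrable_sub_left {t : ℝ} (ht : 0 ≤ t) {g : ℝ → ℝ}
    (hgi : IntegrableOn g (Icc 0 t)) : IntervalIntegrable (fun s => g (t - s)) volume 0 t := by
  have := ((intervalIntegrable_iff_integrableOn_Icc_of_le ht).2 hgi).comp_sub_left t
  simpa using this.symm

theorem intervalIntegrable_smul_apply {E : Type*} [NormedAddCommGroup E] [NormedSpace ℂ E]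
    {S : ℝ → E →L[ℂ] E} (hS : ∀ x, ContinuousOn (fun t => S t x) (Ici 0)) {t : ℝ} (ht : 0 ≤ t) {g : ℝ → ℝ}
    (hgi : IntegrableOn g (Icc 0 t)) (x : E) :
    IntervalIntegrable (fun s => g (t - s) • S s x) volume 0 t := by
  refine (intervalIntegrable_sub_left ht hgi).smul_continuousOn ((hS x).mono ?_)
  rw [uIcc_of_le ht]
  exact Icc_subset_Ici_self

theorem intervalIntegrable_convSf {S : ℝ → X →L[ℂ] X}
    (hS : ∀ x, ContinuousOn (fun t => S t x) (Ici 0)) {t : ℝ} (ht : 0 ≤ t) {h : ℝ → X}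
    (hh : IntervalIntegrable h volume 0 t) :
    IntervalIntegrable (fun s => S (t - s) (h s)) volume 0 t := by
  rw [intervalIntegrable_iff_integrableOn_Ioc_of_le ht] at hh ⊢
  refine IntegrableOn.congr_fun (integrable_apply_of_strongly_continuous hS
    (q := fun s : ℝ => t - s) (by fun_prop) (b := t) ?_ hh) (fun s hs => ?_) measurableSet_Ioc
  · filter_upwards [ae_restrict_mem measurableSet_Ioc] with s hs
    linarith [hs.1]
  · simp [max_eq_left (sub_nonneg.2 hs.2)]

theorem continuous_convK_apply {S : ℝ → X →L[ℂ] X}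
    (hS : ∀ x, ContinuousOn (fun t => S t x) (Ici 0)) {t : ℝ} (ht : 0 ≤ t) {g : ℝ → ℝ}
    (hgi : IntegrableOn g (Icc 0 t)) : Continuous (fun x => convK g (fun s => S s x) t) := by
  obtain ⟨M, hM⟩ := exists_norm_le_of_strongly_continuous hS t
  have hint := (intervalIntegrable_sub_left ht hgi).norm
  refine (LipschitzWith.of_dist_le' (K := (∫ s in (0:ℝ)..t, ‖g (t - s)‖) * M)
    fun x y => ?_).continuous
  rw [dist_eq_norm, dist_eq_norm, convK, convK, ← intervalIntegral.integral_sub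
    (intervalIntegrable_smul_apply hS ht hgi x) (intervalIntegrable_smul_apply hS ht hgi y),
    mul_assoc, ← intervalIntegral.integral_mul_const]
  refine intervalIntegral.norm_integral_le_of_norm_le ht (ae_of_all _ fun s hs => ?_)
    (hint.mul_const _)
  rw [← smul_sub, ← map_sub, norm_smul]
  have := hM s hs.2
  rw [max_eq_left hs.1.le] at this
  gcongr
  exact (S s).le_of_opNorm_le this _

/-- The resolvent equation `S(t)x = x + A (g_α * S)(t)x` extends to all `x`. -/
theorem IsResolventFamily.convK_mem_graph {A : X →ₗ.[ℂ] X} (hdense : Dense (A.domain : Set X))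
    (hclosed : IsClosed (A.graph : Set (X × X))) {α : ℝ} (hα : 0 < α) {S : ℝ → X →L[ℂ] X}
    (hS : IsResolventFamily α A S) {t : ℝ} (ht : 0 ≤ t) (x : X) :
    (convK (gk α) (fun s => S s x) t, S t x - x) ∈ A.graph := by
  obtain ⟨hc, -, hcomm, heq⟩ := hS
  have hgi := integrableOn_gk hα t
  have hcl : IsClosed {x : X | (convK (gk α) (fun s => S s x) t, S t x - x) ∈ A.graph} :=
    hclosed.preimage ((continuous_convK_apply hc ht hgi).prodMk
      ((S t).continuous.sub continuous_id))
  refine hcl.closure_subset_iff.2 ?_ (hdense x)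
  intro x hx
  have h := integral_prodMk_mem_of_isClosed hclosed ht
    (intervalIntegrable_smul_apply hc ht hgi x)
    (intervalIntegrable_smul_apply hc ht hgi (A ⟨x, hx⟩)) (fun s hs => by
      obtain ⟨h2, h3⟩ := hcomm s hs.1.le x hx
      have := A.mem_graph ⟨S s x, h2⟩
      rw [h3] at this
      exact (A.graph.restrictScalars ℝ).smul_mem (gk α (t - s)) this)
  have h' := heq t ht x hx
  rw [mem_ofPred_eq, h', add_sub_cancel_left]
  exact h

/-- The integrated variation of constants formula. -/
theorem IsResolventFamily.integral_eq_of_mild {A : X →ₗ.[ℂ] X}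
    (hdense : Dense (A.domain : Set X))
    (hclosed : IsClosed (A.graph : Set (X × X))) {α : ℝ} (hα : 0 < α) {S : ℝ → X →L[ℂ] X}
    (hS : IsResolventFamily α A S) {t : ℝ} (ht : 0 ≤ t) {u y f : ℝ → X}
    (hu : IntervalIntegrable u volume 0 t) (hy : IntervalIntegrable y volume 0 t)
    (hf : IntervalIntegrable f volume 0 t)
    (h : ∀ s ∈ Ioc 0 t, ∃ hd : convK (gk α) u s ∈ A.domain,
      A ⟨_, hd⟩ = u s - y s - convK (gk α) f s) :
    ∫ s in (0:ℝ)..t, u s = convSf S y t + convK (gk α) (convSf S f) t := by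
  have hgi := integrableOn_gk hα t
  have hg0 : ∀ s < 0, gk α s = 0 := fun s hs => gk_of_neg hs
  obtain ⟨u1, u2, u3, -⟩ := convK_convSf_comm hS.1 ht hg0 hgi
    ((intervalIntegrable_iff_integrableOn_Ioc_of_le ht).1 hu)
  obtain ⟨-, f2, -, f4⟩ := convK_convSf_comm hS.1 ht hg0 hgi
    ((intervalIntegrable_iff_integrableOn_Ioc_of_le ht).1 hf)
  have hSu := intervalIntegrable_convSf hS.1 ht hu
  have hSy := intervalIntegrable_convSf hS.1 ht hy
  have hSf := intervalIntegrable_convSf hS.1 ht f2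
  have h1 := integral_prodMk_mem_of_isClosed hclosed ht u1 (hSu.sub hu) (fun s hs =>
    hS.convK_mem_graph hdense hclosed hα (sub_nonneg.2 hs.2) (u s))
  have h2 := integral_prodMk_mem_of_isClosed hclosed ht
    (intervalIntegrable_convSf hS.1 ht u2) ((hSu.sub hSy).sub hSf) (fun s hs => by
      obtain ⟨hd, he⟩ := h s hs
      obtain ⟨h3, h4⟩ := hS.2.2.1 (t - s) (sub_nonneg.2 hs.2) _ hd
      have := A.mem_graph ⟨_, h3⟩
      rwa [h4, he, map_sub, map_sub] at this)
  rw [u3] at h1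
  have h3 := A.mem_graph_snd_inj h1 h2 rfl
  rw [intervalIntegral.integral_sub hSu hu, intervalIntegral.integral_sub (hSu.sub hSy) hSf,
    intervalIntegral.integral_sub hSu hSy] at h3
  rw [f4]
  simp only [convSf] at h3 ⊢
  rw [sub_sub, sub_right_inj] at h3
  exact h3

theorem convK_gk_one {E : Type*} [NormedAddCommGroup E] [NormedSpace ℂ E] (h : ℝ → E) {t : ℝ} (ht : 0 ≤ t) :
    convK (gk 1) h t = ∫ s in (0:ℝ)..t, h s := by
  refine intervalIntegral.integral_congr fun s hs => ?_
  rw [uIcc_of_le ht] at hs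
  simp [gk_one (sub_nonneg.2 hs.2)]

theorem convSf_const {E : Type*} [NormedAddCommGroup E] [NormedSpace ℂ E]
    (S : ℝ → E →L[ℂ] E) (x : E) (t : ℝ) :
    convSf S (fun _ => x) t = ∫ s in (0:ℝ)..t, S s x := by
  simpa [convSf] using
    intervalIntegral.integral_comp_sub_left (a := 0) (b := t) (fun q => S q x) t

theorem convSf_gk_smul_eq_integral {S : ℝ → X →L[ℂ] X}
    (hS : ∀ x, ContinuousOn (fun t => S t x) (Ici 0)) {t : ℝ} (ht : 0 ≤ t) {k : ℕ} (hk : k < 2)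
    (x : X) :
    convSf S (fun s => gk ((k : ℝ) + 1) s • x) t
      = ∫ s in (0:ℝ)..t, convK0 (k : ℝ) (fun r => S r x) s := by
  have hu : uIcc 0 t = Icc 0 t := uIcc_of_le ht
  obtain rfl | rfl : k = 0 ∨ k = 1 := by omega
  · simp only [Nat.cast_zero, zero_add, convK0, if_true]
    rw [← convSf_const]
    refine intervalIntegral.integral_congr fun s hs => ?_
    rw [hu] at hs
    simp [gk_one hs.1]
  · have h := (convK_convSf_comm hS ht (g := gk 1) (fun s hs => gk_of_neg hs)
      (integrableOn_gk one_pos t) (f := fun _ => x) (by simp)).2.2.2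
    rw [convK_gk_one _ ht] at h
    simp only [Nat.cast_one, convK0, one_ne_zero, if_false]
    rw [intervalIntegral.integral_congr (g := convSf S fun _ => x), h]
    · refine intervalIntegral.integral_congr fun s hs => ?_
      rw [hu] at hs
      simp only [convK_gk_one _ hs.1, show (1:ℝ) + 1 = 2 by norm_num, gk_two hs.1]
      simp
    · intro s hs
      rw [hu] at hs
      simp only [convK_gk_one _ hs.1, convSf_const]

theorem continuousOn_convK0 {E : Type*} [NormedAddCommGroup E] [NormedSpace ℂ E]
    {S : ℝ → E →L[ℂ] E} (hS : ∀ x, ContinuousOn (fun t => S t x) (Ici 0)) {k : ℕ} (hk : k < 2) (x : E) :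
    ContinuousOn (convK0 (k : ℝ) (fun r => S r x)) (Ici 0) := by
  obtain rfl | rfl : k = 0 ∨ k = 1 := by omega
  · refine (hS x).congr fun s _ => ?_
    simp [convK0]
  · have hc : Continuous (fun q : ℝ => S (max q 0) x) :=
      (hS x).comp_continuous (by fun_prop) fun q => mem_Ici.2 (le_max_right _ _)
    refine (intervalIntegral.continuous_primitive (μ := volume)
      (fun a b => hc.intervalIntegrable a b) 0).continuousOn.congr fun s hs => ?_
    simp only [Nat.cast_one, convK0, one_ne_zero, if_false]
    rw [convK_gk_one _ hs]
    refine intervalIntegral.integral_congr fun r hr => ?_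
    rw [uIcc_of_le hs] at hr
    simp [max_eq_left hr.1]

theorem Icc_subset_Jset {τ : ℝ≥0∞} {t : ℝ} (ht : t ∈ Jset τ) : Icc 0 t ⊆ Jset τ :=
  fun _ hs => ⟨hs.1, (ENNReal.ofReal_le_ofReal hs.2).trans_lt ht.2⟩

theorem exists_gt_mem_Jset {τ : ℝ≥0∞} {t : ℝ} (ht : t ∈ Jset τ) : ∃ b ∈ Jset τ, t < b := by
  obtain ⟨b, hb⟩ := (((ENNReal.continuous_ofReal.tendsto t).eventually
    (gt_mem_nhds ht.2)).filter_mono nhdsWithin_le_nhds |>.and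
      (self_mem_nhdsWithin : Ioi t ∈ 𝓝[>] t)).exists
  exact ⟨b, ⟨ht.1.trans hb.2.le, hb.1⟩, hb.2⟩

theorem hasDerivWithinAt_integral_Jset {τ : ℝ≥0∞} {w : ℝ → X} (hw : ContinuousOn w (Jset τ))
    {t : ℝ} (ht : t ∈ Jset τ) :
    HasDerivWithinAt (fun r => ∫ s in (0:ℝ)..r, w s) (w t) (Jset τ) t := by
  obtain ⟨b, hb, htb⟩ := exists_gt_mem_Jset ht
  have h0b : (0:ℝ) ≤ b := hb.1
  set W : ℝ → X := IccExtend h0b ((Icc 0 b).domRestrict w)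
  have hW : Continuous W := ((hw.mono (Icc_subset_Jset hb)).domRestrict).Icc_extend'
  have hWw : ∀ s ∈ Icc 0 b, W s = w s := fun s hs => IccExtend_of_mem h0b _ hs
  have h := intervalIntegral.integral_hasDerivAt_right (hW.intervalIntegrable 0 t)
    hW.aestronglyMeasurable.stronglyMeasurableAtFilter hW.continuousAt
  rw [hWw t ⟨ht.1, htb.le⟩] at h
  have key : ∀ r ∈ Icc 0 b, ∫ s in (0:ℝ)..r, w s = ∫ s in (0:ℝ)..r, W s := fun r hr =>
    intervalIntegral.integral_congr fun s hs => by
      rw [uIcc_of_le hr.1] at hs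
      exact (hWw s ⟨hs.1, hs.2.trans hr.2⟩).symm
  refine h.hasDerivWithinAt.congr_of_eventuallyEq ?_ (key t ⟨ht.1, htb.le⟩)
  filter_upwards [self_mem_nhdsWithin, mem_nhdsWithin_of_mem_nhds (Iio_mem_nhds htb)] with r hr hr'
  exact key r ⟨hr.1, (mem_Iio.1 hr').le⟩

/-- Proposition 4.2: if `A` generates an `α`-times resolvent family
`S_α` and `f ∈ L¹_loc([0,τ);X)`, then any mild solution of
`D_t^α u = Au + f`, `u^{(k)}(0) = x_k`, is given by
`u(t) = Σ_{k<m} (g_k * S_α)(t)x_k + (d/dt)(g_α * S_α * f)(t)`; in particular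
`g_α * S_α * f` is differentiable on `[0,τ)`. -/
theorem statement12 (A : X →ₗ.[ℂ] X)
    (hdense : Dense (A.domain : Set X)) (hclosed : IsClosed (A.graph : Set (X × X)))
    (α : ℝ) (hα : α ∈ Set.Ioc (0:ℝ) 2) (τ : ℝ≥0∞) (hτ : 0 < τ)
    (S : ℝ → X →L[ℂ] X) (hS : IsResolventFamily α A S)
    (f : ℝ → X) (hf : ∀ b : ℝ, 0 ≤ b → ENNReal.ofReal b < τ → IntegrableOn f (Icc 0 b))
    (x : ℕ → X) (u : ℝ → X) (hu : IsMildSolution α A τ f x u) :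
    ∃ v : ℝ → X,
      (∀ t ∈ Jset τ, HasDerivWithinAt (convK (gk α) (convSf S f)) (v t) (Jset τ) t) ∧
      ∀ t ∈ Jset τ,
        u t = (∑ k ∈ Finset.range ⌈α⌉₊, convK0 (k : ℝ) (fun s => S s (x k)) t) + v t := by


  have hα2 : ∀ k ∈ Finset.range ⌈α⌉₊, k < 2 := fun k hk =>
    (Finset.mem_range.1 hk).trans_le (Nat.ceil_le.2 (by exact_mod_cast hα.2))
  set w : ℝ → X := fun t =>
    u t - ∑ k ∈ Finset.range ⌈α⌉₊, convK0 (k : ℝ) (fun s => S s (x k)) t with hw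
  have hc : ∀ k ∈ Finset.range ⌈α⌉₊,
      ContinuousOn (convK0 (k : ℝ) (fun s => S s (x k))) (Jset τ) := fun k hk =>
    (continuousOn_convK0 hS.1 (hα2 k hk) (x k)).mono fun s hs => hs.1
  have hwc : ContinuousOn w (Jset τ) := hu.1.sub (continuousOn_finsetSum _ hc)
  have hJ : ∀ {t : ℝ}, t ∈ Jset τ → uIcc 0 t ⊆ Jset τ := fun {t} ht => by
    rw [uIcc_of_le ht.1]
    exact Icc_subset_Jset ht
  have key : ∀ t ∈ Jset τ, convK (gk α) (convSf S f) t = ∫ s in (0:ℝ)..t, w s := by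
    intro t ht
    have ht0 : 0 ≤ t := ht.1
    have hy : ∀ k ∈ Finset.range ⌈α⌉₊,
        IntervalIntegrable (fun s => gk ((k : ℝ) + 1) s • x k) volume 0 t := fun k _ =>
      (IntegrableOn.intervalIntegrable
        (by rw [uIcc_of_le ht0]; exact integrableOn_gk (by positivity) t)).smul_continuousOn
        continuousOn_const
    have hui := (hu.1.mono (hJ ht)).intervalIntegrable (μ := volume)
    have h := hS.integral_eq_of_mild hdense hclosed hα.1 ht0 hui
      (IntervalIntegrable.sum _ hy)
      ((intervalIntegrable_iff_integrableOn_Icc_of_le ht0).2 (hf t ht0 ht.2)) (fun s hs => by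
        obtain ⟨hd, he⟩ := hu.2 s (Icc_subset_Jset ht (Ioc_subset_Icc_self hs))
        refine ⟨hd, ?_⟩
        rw [he, Finset.sum_apply]
        abel)
    have hsum : convSf S (∑ k ∈ Finset.range ⌈α⌉₊, fun s => gk ((k : ℝ) + 1) s • x k) t
        = ∫ s in (0:ℝ)..t,
          ∑ k ∈ Finset.range ⌈α⌉₊, convK0 (k : ℝ) (fun s => S s (x k)) s := by
      rw [intervalIntegral.integral_finsetSum fun k hk =>
        ((hc k hk).mono (hJ ht)).intervalIntegrable]
      simp only [convSf, Finset.sum_apply, map_sum]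
      rw [intervalIntegral.integral_finsetSum fun k hk =>
        intervalIntegrable_convSf hS.1 ht0 (hy k hk)]
      exact Finset.sum_congr rfl fun k hk =>
        convSf_gk_smul_eq_integral hS.1 ht0 (hα2 k hk) (x k)
    rw [hw, intervalIntegral.integral_sub hui
      ((continuousOn_finsetSum _ hc).mono (hJ ht)).intervalIntegrable, h, hsum,
      add_sub_cancel_left]
  refine ⟨w, fun t ht => ?_, fun t _ => by simp [hw]⟩
  exact (hasDerivWithinAt_integral_Jset hwc ht).congr key (key t ht)

end
end

section
/- Let m ∈ ℕ and suppose A generates a (1/m)-times resolvent family S_{1/m} on a complex Banach space X. Then for each x ∈ D(A^m), the function u(t) := S_{1/m}(t)x solves the fractional Cauchy problem D_t^{1/m} u(t) = A u(t) for t > 0, u(0) = x, and also solves the first-order initial value problem v'(t) = A^m v(t) + Σ_{k=1}^{m−1} g_{k/m}(t) A^k x for t > 0, v(0) = x. -/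
open MeasureTheory Filter Set Topology Metric
open scoped Real Topology ENNReal

attribute [local instance] Classical.propDecidable
noncomputable section

variable {X : Type*} [NormedAddCommGroup X] [NormedSpace ℂ X] [CompleteSpace X]

section Kernel

variable {E : Type*} [NormedAddCommGroup E] [NormedSpace ℝ E]

lemma gk_of_nonneg {t : ℝ} (β : ℝ) (ht : 0 ≤ t) : gk β t = t ^ (β - 1) / Real.Gamma β :=
  if_pos ht

lemma gk_of_neg_s17 {t : ℝ} (β : ℝ) (ht : t < 0) : gk β t = 0 :=
  if_neg ht.not_ge

lemma gk_one_s17 {t : ℝ} (ht : 0 ≤ t) : gk 1 t = 1 := by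
  simp [gk_of_nonneg 1 ht]

lemma gk_nonneg {β : ℝ} (hβ : 0 < β) (t : ℝ) : 0 ≤ gk β t := by
  unfold gk
  split_ifs with h
  · exact div_nonneg (Real.rpow_nonneg h _) (Real.Gamma_pos_of_pos hβ).le
  · exact le_rfl

lemma gk_pos {β t : ℝ} (hβ : 0 < β) (ht : 0 < t) : 0 < gk β t := by
  rw [gk_of_nonneg β ht.le]
  exact div_pos (Real.rpow_pos_of_pos ht _) (Real.Gamma_pos_of_pos hβ)

lemma measurable_gk (β : ℝ) : Measurable (gk β) := by
  unfold gk
  exact Measurable.ite measurableSet_Ici (by fun_prop) measurable_const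

lemma intervalIntegrable_gk {β t : ℝ} (hβ : 0 < β) (ht : 0 ≤ t) :
    IntervalIntegrable (gk β) volume 0 t := by
  refine ((intervalIntegral.intervalIntegrable_rpow' (r := β - 1) (by linarith)).div_const
    (Real.Gamma β)).congr ?_
  intro s hs
  rw [uIoc_of_le ht] at hs
  exact (gk_of_nonneg β hs.1.le).symm

lemma intervalIntegrable_gk_sub {β t : ℝ} (hβ : 0 < β) (ht : 0 ≤ t) :
    IntervalIntegrable (fun s => gk β (t - s)) volume 0 t := by
  simpa using ((intervalIntegrable_gk hβ ht).comp_sub_left t).symm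

lemma intervalIntegrable_gk_sub_smul {β t : ℝ} (hβ : 0 < β) (ht : 0 ≤ t) {f : ℝ → E}
    (hf : ContinuousOn f (Ici 0)) :
    IntervalIntegrable (fun s => gk β (t - s) • f s) volume 0 t := by
  refine (intervalIntegrable_gk_sub hβ ht).smul_continuousOn (hf.mono ?_)
  rw [uIcc_of_le ht]
  exact Icc_subset_Ici_self

/-- The semigroup property `g_a * g_b = g_{a+b}` of the kernels. -/
lemma integral_gk_sub_mul_gk {a b t : ℝ} (ha : 0 < a) (hb : 0 < b) (ht : 0 < t) :
    ∫ s in (0:ℝ)..t, gk a (t - s) * gk b s = gk (a + b) t := by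
  have h := Complex.betaIntegral_scaled (b : ℂ) (a : ℂ) ht
  rw [Complex.betaIntegral_eq_Gamma_mul_div _ _ (by simpa) (by simpa)] at h
  have key : ∫ s in (0:ℝ)..t, s ^ (b - 1) * (t - s) ^ (a - 1)
      = t ^ (b + a - 1) * (Real.Gamma b * Real.Gamma a / Real.Gamma (b + a)) := by
    apply Complex.ofReal_injective
    rw [← intervalIntegral.integral_ofReal]
    push_cast [Complex.ofReal_cpow ht.le, ← Complex.Gamma_ofReal]
    rw [← h]
    refine intervalIntegral.integral_congr fun s hs => ?_
    rw [uIcc_of_le ht.le] at hs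
    have h1 : (0:ℝ) ≤ t - s := sub_nonneg.2 hs.2
    simp only [Complex.ofReal_cpow hs.1, Complex.ofReal_cpow h1]
    push_cast
    rfl
  have h2 : ∫ s in (0:ℝ)..t, gk a (t - s) * gk b s
      = ∫ s in (0:ℝ)..t, (Real.Gamma a * Real.Gamma b)⁻¹ * (s ^ (b - 1) * (t - s) ^ (a - 1)) := by
    refine intervalIntegral.integral_congr fun s hs => ?_
    rw [uIcc_of_le ht.le] at hs
    simp only [gk_of_nonneg b hs.1, gk_of_nonneg a (sub_nonneg.2 hs.2)]
    field_simp
  have hA := (Real.Gamma_pos_of_pos ha).ne'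
  have hB := (Real.Gamma_pos_of_pos hb).ne'
  rw [h2, intervalIntegral.integral_const_mul, key, gk_of_nonneg _ ht.le, add_comm b a]
  field_simp

lemma intervalIntegrable_gk_sub_mul_gk {a b t : ℝ} (ha : 0 < a) (hb : 0 < b) (ht : 0 < t) :
    IntervalIntegrable (fun s => gk a (t - s) * gk b s) volume 0 t := by
  by_contra h
  have := integral_gk_sub_mul_gk ha hb ht
  rw [intervalIntegral.integral_undef h] at this
  exact (gk_pos (add_pos ha hb) ht).ne this

lemma integral_gk_sub {β t : ℝ} (hβ : 0 < β) (ht : 0 < t) :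
    ∫ s in (0:ℝ)..t, gk β (t - s) = gk (1 + β) t := by
  rw [add_comm, ← integral_gk_sub_mul_gk hβ one_pos ht]
  refine intervalIntegral.integral_congr fun s hs => ?_
  rw [uIcc_of_le ht.le] at hs
  simp [gk_one_s17 hs.1]

lemma integrableOn_gk_sub_mul_gk_sub {a b r t : ℝ} (ha : 0 < a) (hb : 0 < b) (hr : r ∈ Ioo 0 t) :
    IntegrableOn (fun s => gk a (t - s) * gk b (s - r)) (Ioo 0 t) := by
  have h := (intervalIntegrable_gk_sub_mul_gk ha hb (sub_pos.2 hr.2)).comp_sub_right r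
  simp only [zero_add, sub_add_cancel, sub_sub_sub_cancel_right] at h
  rw [intervalIntegrable_iff_integrableOn_Ioo_of_le hr.2.le] at h
  rw [← integrableOn_Ico_iff_integrableOn_Ioo] at h
  refine h.of_forall_sdiff_eq_zero measurableSet_Ioo fun s hs => ?_
  have : s < r := by
    by_contra! h'
    exact hs.2 ⟨h', hs.1.2⟩
  simp [gk_of_neg_s17 b (sub_neg.2 this)]

lemma setIntegral_gk_sub_mul_gk_sub {a b r t : ℝ} (ha : 0 < a) (hb : 0 < b) (hr : r ∈ Ioo 0 t) :
    ∫ s in Ioo 0 t, gk a (t - s) * gk b (s - r) = gk (a + b) (t - r) := by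
  have h := intervalIntegral.integral_comp_sub_right (a := r) (b := t)
    (fun s => gk a (t - r - s) * gk b s) r
  simp only [sub_self, sub_sub_sub_cancel_right] at h
  rw [← integral_gk_sub_mul_gk ha hb (sub_pos.2 hr.2), ← h,
    intervalIntegral.integral_of_le hr.2.le, integral_Ioc_eq_integral_Ioo,
    ← integral_Ico_eq_integral_Ioo (x := r)]
  refine setIntegral_eq_of_subset_of_forall_sdiff_eq_zero measurableSet_Ioo
    (Ico_subset_Ioo_left hr.1) fun s hs => ?_
  have : s < r := by
    by_contra! h'
    exact hs.2 ⟨h', hs.1.2⟩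
  simp [gk_of_neg_s17 b (sub_neg.2 this)]

/-- Associativity `g_a * (g_b * f) = g_{a+b} * f` of convolution with the kernels. -/
lemma integral_gk_sub_smul_integral {a b t : ℝ} (ha : 0 < a) (hb : 0 < b) (ht : 0 < t)
    [CompleteSpace E] {f : ℝ → E} (hf : ContinuousOn f (Ici 0)) :
    ∫ s in (0:ℝ)..t, gk a (t - s) • ∫ r in (0:ℝ)..s, gk b (s - r) • f r
      = ∫ r in (0:ℝ)..t, gk (a + b) (t - r) • f r := by
  set μ : Measure ℝ := volume.restrict (Ioo 0 t) with hμ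
  have hmem : ∀ᵐ r ∂μ, r ∈ Ioo 0 t := ae_restrict_mem measurableSet_Ioo
  have hfm : AEStronglyMeasurable f μ :=
    (hf.mono fun s hs => hs.1.le).aestronglyMeasurable measurableSet_Ioo
  have hint : Integrable
      (Function.uncurry fun s r => (gk a (t - s) * gk b (s - r)) • f r) (μ.prod μ) := by
    have hm : AEStronglyMeasurable
        (Function.uncurry fun s r => (gk a (t - s) * gk b (s - r)) • f r) (μ.prod μ) := by
      refine AEStronglyMeasurable.smul (Measurable.aestronglyMeasurable ?_) hfm.comp_snd
      exact ((measurable_gk a).comp (measurable_const.sub measurable_fst)).mul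
        ((measurable_gk b).comp (measurable_fst.sub measurable_snd))
    refine (integrable_prod_iff' hm).2 ⟨?_, ?_⟩
    · filter_upwards [hmem] with r hr
      exact (integrableOn_gk_sub_mul_gk_sub ha hb hr).smul_const (f r)
    · have h := (intervalIntegrable_gk_sub_smul (add_pos ha hb) ht.le hf).norm
      rw [intervalIntegrable_iff_integrableOn_Ioo_of_le ht.le] at h
      refine h.congr ?_
      filter_upwards [hmem] with r hr
      simp only [Function.uncurry, norm_smul, norm_mul, Real.norm_of_nonneg (gk_nonneg ha _),
        Real.norm_of_nonneg (gk_nonneg hb _), Real.norm_of_nonneg (gk_nonneg (add_pos ha hb) _)]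
      rw [integral_mul_const, setIntegral_gk_sub_mul_gk_sub ha hb hr]
  rw [intervalIntegral.integral_of_le ht.le, intervalIntegral.integral_of_le ht.le,
    integral_Ioc_eq_integral_Ioo, integral_Ioc_eq_integral_Ioo]
  calc ∫ s in Ioo 0 t, gk a (t - s) • ∫ r in (0:ℝ)..s, gk b (s - r) • f r
      = ∫ s, ∫ r, (gk a (t - s) * gk b (s - r)) • f r ∂μ ∂μ := by
        refine setIntegral_congr_fun measurableSet_Ioo fun s hs => ?_
        simp only [mul_smul]
        rw [integral_smul, intervalIntegral.integral_of_le hs.1.le]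
        congr 1
        refine (setIntegral_eq_of_subset_of_forall_sdiff_eq_zero measurableSet_Ioo
          (fun r hr => ⟨hr.1, hr.2.trans_lt hs.2⟩) fun r hr => ?_).symm
        have : s < r := by
          by_contra! h'
          exact hr.2 ⟨hr.1.1, h'⟩
        simp [gk_of_neg_s17 b (sub_neg.2 this)]
    _ = ∫ r, ∫ s, (gk a (t - s) * gk b (s - r)) • f r ∂μ ∂μ := integral_integral_swap hint
    _ = ∫ r in Ioo 0 t, gk (a + b) (t - r) • f r := by
        refine setIntegral_congr_fun measurableSet_Ioo fun r hr => ?_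
        rw [integral_smul_const, setIntegral_gk_sub_mul_gk_sub ha hb hr]

lemma hasDerivAt_gk_one_add {β t : ℝ} (hβ : 0 < β) (ht : 0 < t) :
    HasDerivAt (gk (1 + β)) (gk β t) t := by
  have h := (Real.hasDerivAt_rpow_const (x := t) (p := β) (Or.inl ht.ne')).div_const
    (Real.Gamma (β + 1))
  have hG := (Real.Gamma_pos_of_pos hβ).ne'
  have h' : β * t ^ (β - 1) / Real.Gamma (β + 1) = gk β t := by
    rw [Real.Gamma_add_one hβ.ne', gk_of_nonneg β ht.le]
    field_simp
  rw [h'] at h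
  refine h.congr_of_eventuallyEq ?_
  filter_upwards [lt_mem_nhds ht] with s hs
  rw [gk_of_nonneg _ hs.le, add_sub_cancel_left, add_comm]

/-- Iterating `f_j = y_j + g_α * f_{j+1}` gives a finite Taylor expansion with remainder. -/
lemma eq_sum_gk_smul_add_integral [CompleteSpace E] {α : ℝ} (hα : 0 < α) {f : ℕ → ℝ → E}
    {y : ℕ → E} {n : ℕ} (hf : ∀ j, ContinuousOn (f j) (Ici 0))
    (h : ∀ j ≤ n, ∀ t, 0 ≤ t →
      f j t = y j + ∫ s in (0:ℝ)..t, gk α (t - s) • f (j + 1) s) {t : ℝ} (ht : 0 < t) :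
    f 0 t = ∑ k ∈ Finset.range (n + 1), gk (1 + k * α) t • y k
      + ∫ s in (0:ℝ)..t, gk ((n + 1 : ℕ) * α) (t - s) • f (n + 1) s := by
  induction n with
  | zero => simpa [gk_one_s17 ht.le] using h 0 le_rfl t ht.le
  | succ n ih =>
    have hβ : 0 < ((n + 1 : ℕ) : ℝ) * α := by positivity
    set β := ((n + 1 : ℕ) : ℝ) * α with hβ_def
    have hcongr : ∫ s in (0:ℝ)..t, gk β (t - s) • f (n + 1) s
        = ∫ s in (0:ℝ)..t, (gk β (t - s) • y (n + 1)
          + gk β (t - s) • ∫ r in (0:ℝ)..s, gk α (s - r) • f (n + 1 + 1) r) := by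
      refine intervalIntegral.integral_congr fun s hs => ?_
      rw [uIcc_of_le ht.le] at hs
      rw [h (n + 1) le_rfl s hs.1, smul_add]
    have hi := intervalIntegrable_gk_sub_smul hβ ht.le (f := fun _ => y (n + 1)) continuousOn_const
    have hi' : IntervalIntegrable (fun s => gk β (t - s) •
        ∫ r in (0:ℝ)..s, gk α (s - r) • f (n + 1 + 1) r) volume 0 t := by
      refine ((intervalIntegrable_gk_sub_smul hβ ht.le (hf (n + 1))).sub hi).congr ?_
      intro s hs
      rw [uIoc_of_le ht.le] at hs
      simp only
      rw [h (n + 1) le_rfl s hs.1.le, smul_add, add_sub_cancel_left]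
    have hadd : β + α = ((n + 1 + 1 : ℕ) : ℝ) * α := by
      rw [hβ_def]
      push_cast
      ring
    rw [ih fun j hj => h j (hj.trans n.le_succ), hcongr, intervalIntegral.integral_add hi hi',
      integral_gk_sub_smul_integral hβ hα ht (hf _), intervalIntegral.integral_smul_const,
      integral_gk_sub hβ ht, Finset.sum_range_succ _ (n + 1), hadd, ← hβ_def,
      add_assoc (Finset.sum _ _)]

lemma convK_gk_add_sum {a t : ℝ} (ha : 0 < a) (ht : 0 < t) {f : ℝ → X}
    (hf : ContinuousOn f (Ici 0)) (F : Finset ℕ) {b : ℕ → ℝ} (hb : ∀ k ∈ F, 0 < b k)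
    (y : ℕ → X) :
    convK (gk a) (fun s => f s + ∑ k ∈ F, gk (b k) s • y k) t
      = (∫ s in (0:ℝ)..t, gk a (t - s) • f s) + ∑ k ∈ F, gk (a + b k) t • y k := by
  have hi : ∀ k ∈ F, IntervalIntegrable (fun s => (gk a (t - s) * gk (b k) s) • y k) volume 0 t :=
    fun k hk => (intervalIntegrable_gk_sub_mul_gk ha (hb k hk) ht).smul_continuousOn
      continuousOn_const
  simp only [convK, smul_add, Finset.smul_sum, ← mul_smul]
  rw [intervalIntegral.integral_add (intervalIntegrable_gk_sub_smul ha ht.le hf)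
    (by simpa only [← Finset.sum_fn] using IntervalIntegrable.sum F hi),
    intervalIntegral.integral_finsetSum hi]
  congr 1
  refine Finset.sum_congr rfl fun k hk => ?_
  rw [intervalIntegral.integral_smul_const, integral_gk_sub_mul_gk ha (hb k hk) ht]

end Kernel

section Iterates

variable {Y : Type*} [NormedAddCommGroup Y] [NormedSpace ℂ Y]

lemma pApply_of_mem {A : Y →ₗ.[ℂ] Y} {x : Y} (hx : x ∈ A.domain) : pApply A x = A ⟨x, hx⟩ :=
  dif_pos hx

lemma IsResolventFamily.iterate_pApply {α : ℝ} {A : Y →ₗ.[ℂ] Y} {S : ℝ → Y →L[ℂ] Y}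
    (hS : IsResolventFamily α A S) {t : ℝ} (ht : 0 ≤ t) {x : Y} {k : ℕ}
    (hx : ∀ j < k, (pApply A)^[j] x ∈ A.domain) :
    (pApply A)^[k] (S t x) = S t ((pApply A)^[k] x) := by
  induction k with
  | zero => rfl
  | succ k ih =>
    have hk := hx k k.lt_succ_self
    obtain ⟨h1, h2⟩ := hS.2.2.1 t ht _ hk
    rw [Function.iterate_succ_apply', Function.iterate_succ_apply',
      ih fun j hj => hx j (hj.trans k.lt_succ_self), pApply_of_mem h1, pApply_of_mem hk, h2]

/-- The Volterra equation along the orbit `x, A x, A² x, …`. -/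
lemma IsResolventFamily.apply_iterate_eq {α : ℝ} {A : Y →ₗ.[ℂ] Y} {S : ℝ → Y →L[ℂ] Y}
    (hS : IsResolventFamily α A S) {t : ℝ} (ht : 0 ≤ t) {x : Y} {j : ℕ}
    (hx : (pApply A)^[j] x ∈ A.domain) :
    S t ((pApply A)^[j] x)
      = (pApply A)^[j] x + ∫ s in (0:ℝ)..t, gk α (t - s) • S s ((pApply A)^[j + 1] x) := by
  rw [Function.iterate_succ_apply', pApply_of_mem hx]
  exact hS.2.2.2 t ht _ hx

end Iterates

lemma IsResolventFamily.hasDerivAt {A : X →ₗ.[ℂ] X} {m : ℕ} (hm : 1 ≤ m)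
    {S : ℝ → X →L[ℂ] X} (hS : IsResolventFamily (1 / (m : ℝ)) A S) {x : X}
    (hx : ∀ k < m, (pApply A)^[k] x ∈ A.domain) {t : ℝ} (ht : 0 < t) :
    HasDerivAt (fun r => S r x)
      (S t ((pApply A)^[m] x)
        + ∑ k ∈ Finset.Ico 1 m, gk ((k : ℝ) / m) t • (pApply A)^[k] x) t := by
  have hm0 : (0 : ℝ) < m := by exact_mod_cast hm
  have hc := hS.1 ((pApply A)^[m] x)
  have heq : ∀ r : ℝ, 0 < r → S r x = x + (∑ k ∈ Finset.Ico 1 m,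
      gk (1 + (k : ℝ) / m) r • (pApply A)^[k] x + ∫ s in (0:ℝ)..r, S s ((pApply A)^[m] x)) := by
    intro r hr
    obtain ⟨n, rfl⟩ : ∃ n, m = n + 1 := ⟨m - 1, by omega⟩
    have h := eq_sum_gk_smul_add_integral (one_div_pos.2 hm0)
      (f := fun j r => S r ((pApply A)^[j] x)) (y := fun j => (pApply A)^[j] x) (n := n)
      (fun j => hS.1 _)
      (fun j hj s hs => hS.apply_iterate_eq hs (hx j (Nat.lt_succ_of_le hj))) hr
    rw [mul_one_div_cancel hm0.ne', Finset.range_eq_Ico,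
      Finset.sum_eq_sum_Ico_succ_bot n.succ_pos] at h
    simp only [Function.iterate_zero, id, Nat.cast_zero, zero_div, add_zero, gk_one_s17 hr.le,
      one_smul, mul_one_div, zero_add, add_assoc] at h
    rw [h]
    congr 2
    refine intervalIntegral.integral_congr fun s hs => ?_
    rw [uIcc_of_le hr.le] at hs
    simp [gk_one_s17 (sub_nonneg.2 hs.2)]
  have hI : HasDerivAt (fun r => ∫ s in (0:ℝ)..r, S s ((pApply A)^[m] x))
      (S t ((pApply A)^[m] x)) t := by
    refine intervalIntegral.integral_hasDerivAt_right ?_ ?_ (hc.continuousAt (Ici_mem_nhds ht))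
    · refine (hc.mono ?_).intervalIntegrable
      rw [uIcc_of_le ht.le]
      exact Icc_subset_Ici_self
    · exact (hc.mono Ioi_subset_Ici_self).stronglyMeasurableAtFilter isOpen_Ioi t ht
  have hsum : HasDerivAt (fun r => ∑ k ∈ Finset.Ico 1 m,
      gk (1 + (k : ℝ) / m) r • (pApply A)^[k] x)
      (∑ k ∈ Finset.Ico 1 m, gk ((k : ℝ) / m) t • (pApply A)^[k] x) t := by
    refine HasDerivAt.fun_sum fun k hk => ?_
    have hk0 : (0 : ℝ) < k := by exact_mod_cast (Finset.mem_Ico.1 hk).1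
    exact (hasDerivAt_gk_one_add (div_pos hk0 hm0) ht).smul_const _
  rw [add_comm (S t _)]
  refine ((hsum.add hI).const_add x).congr_of_eventuallyEq ?_
  filter_upwards [lt_mem_nhds ht] with r hr using heq r hr

lemma IsResolventFamily.convK0_deriv {A : X →ₗ.[ℂ] X} {m : ℕ} (hm : 1 ≤ m)
    {S : ℝ → X →L[ℂ] X} (hS : IsResolventFamily (1 / (m : ℝ)) A S) {x : X}
    (hx : ∀ k < m, (pApply A)^[k] x ∈ A.domain) {t : ℝ} (ht : 0 < t) :
    convK0 (1 - 1 / (m : ℝ)) (fun t => S t ((pApply A)^[m] x)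
        + ∑ k ∈ Finset.Ico 1 m, gk ((k : ℝ) / m) t • (pApply A)^[k] x) t
      = S t (pApply A x) := by
  obtain rfl | hm2 := hm.eq_or_lt
  · simp [convK0]
  obtain ⟨n, rfl⟩ : ∃ n, m = n + 2 := ⟨m - 2, by omega⟩
  have hm0 : (0 : ℝ) < (n + 2 : ℕ) := by positivity
  have ha : 1 - 1 / ((n + 2 : ℕ) : ℝ) = ((n + 1 : ℕ) : ℝ) * (1 / ((n + 2 : ℕ) : ℝ)) := by
    field_simp
    push_cast
    ring
  have ha0 : 0 < 1 - 1 / ((n + 2 : ℕ) : ℝ) := by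
    rw [ha]
    positivity
  have h := eq_sum_gk_smul_add_integral (one_div_pos.2 hm0)
    (f := fun j r => S r ((pApply A)^[j + 1] x)) (y := fun j => (pApply A)^[j + 1] x) (n := n)
    (fun j => hS.1 _)
    (fun j hj s hs => hS.apply_iterate_eq hs (hx (j + 1) (by omega))) ht
  simp only [zero_add, Function.iterate_one] at h
  rw [convK0, if_neg ha0.ne', convK_gk_add_sum ha0 ht (hS.1 _) _ _ _, h, add_comm, ← ha,
    Finset.sum_Ico_eq_sum_range]
  · congr 1
    refine Finset.sum_congr rfl fun k _ => ?_
    rw [add_comm 1 k]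
    congr 2
    field_simp
    push_cast
    ring
  · intro k hk
    have hk0 : (0 : ℝ) < k := by exact_mod_cast (Finset.mem_Ico.1 hk).1
    exact div_pos hk0 hm0

/-- Proposition 4.6: if `A` generates a `(1/m)`-times resolvent family
`S_{1/m}`, then for `x ∈ D(A^m)`, `u(t) = S_{1/m}(t)x` solves the fractional Cauchy
problem `D_t^{1/m} u = Au`, `u(0) = x`, and the first-order problem
`v' = A^m v + Σ_{k=1}^{m-1} g_{k/m}(t) A^k x`, `v(0) = x`. -/
theorem statement17 (A : X →ₗ.[ℂ] X) (m : ℕ) (hm : 1 ≤ m)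
    (S : ℝ → X →L[ℂ] X) (hS : IsResolventFamily (1 / (m : ℝ)) A S)
    (x : X) (hx : ∀ k < m, (pApply A)^[k] x ∈ A.domain) :
    S 0 x = x ∧
    (∃ u' : ℝ → X, (∀ t : ℝ, 0 < t → HasDerivAt (fun r => S r x) (u' t) t) ∧
      ∀ t : ℝ, 0 < t → ∃ h : S t x ∈ A.domain,
        convK0 (1 - 1 / (m : ℝ)) u' t = A ⟨S t x, h⟩) ∧
    (∃ u' : ℝ → X, (∀ t : ℝ, 0 < t → HasDerivAt (fun r => S r x) (u' t) t) ∧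
      ∀ t : ℝ, 0 < t → (∀ k < m, (pApply A)^[k] (S t x) ∈ A.domain) ∧
        u' t = (pApply A)^[m] (S t x)
          + ∑ k ∈ Finset.Ico 1 m, gk ((k : ℝ) / m) t • (pApply A)^[k] x) := by
  refine ⟨by simp [hS.2.1], ⟨_, fun t ht => hS.hasDerivAt hm hx ht, fun t ht => ?_⟩,
    ⟨_, fun t ht => hS.hasDerivAt hm hx ht, fun t ht => ⟨fun k hk => ?_, ?_⟩⟩⟩
  · have hx0 : x ∈ A.domain := hx 0 hm
    obtain ⟨h1, h2⟩ := hS.2.2.1 t ht.le x hx0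
    exact ⟨h1, by rw [hS.convK0_deriv hm hx ht, pApply_of_mem hx0, h2]⟩
  · rw [hS.iterate_pApply ht.le fun j hj => hx j (hj.trans hk)]
    exact (hS.2.2.1 t ht.le _ (hx k hk)).1
  · rw [hS.iterate_pApply ht.le hx]

end
end
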